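/- For all m ≥ 1 and all n ≥ 3 + m, the highest power of x that occurs in the polynomial Q_{n,132}^{(1,1,m,0)}(x) is x^{n-2-m}, and its coefficient equals 2·C_m; that is, the coefficient of x^{n-2-m} in Q_{n,132}^{(1,1,m,0)}(x) is 2·C_m and the coefficient of x^r is 0 for every r > n-2-m. -/

import Mathlib

open Finset Polynomial

/-- `σ i` matches the quadrant marked mesh pattern `MMP(a,b,c,d)` in `σ`:
there are at least `a` indices `j > i` with `σ j > σ i`, at least `b` indices
`j < i` with `σ j > σ i`, at least `c` indices `j < i` with `σ j < σ i`, and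
at least `d` indices `j > i` with `σ j < σ i`. -/
def MatchesMMP {n : ℕ} (a b c d : ℕ) (σ : Equiv.Perm (Fin n)) (i : Fin n) : Prop :=
  a ≤ (Finset.univ.filter (fun j => i < j ∧ σ i < σ j)).card ∧
  b ≤ (Finset.univ.filter (fun j => j < i ∧ σ i < σ j)).card ∧
  c ≤ (Finset.univ.filter (fun j => j < i ∧ σ j < σ i)).card ∧
  d ≤ (Finset.univ.filter (fun j => i < j ∧ σ j < σ i)).card

instance {n : ℕ} (a b c d : ℕ) (σ : Equiv.Perm (Fin n)) :
    DecidablePred (MatchesMMP a b c d σ) := fun i => by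
  unfold MatchesMMP; infer_instance

/-- `mmp a b c d σ` is the number of indices `i` such that `σ i` matches
`MMP(a,b,c,d)` in `σ`. -/
def mmp {n : ℕ} (a b c d : ℕ) (σ : Equiv.Perm (Fin n)) : ℕ :=
  (Finset.univ.filter (MatchesMMP a b c d σ)).card

/-- `σ` avoids the classical pattern 132. -/
def Avoids132 {n : ℕ} (σ : Equiv.Perm (Fin n)) : Prop :=
  ¬ ∃ i j k : Fin n, i < j ∧ j < k ∧ σ i < σ k ∧ σ k < σ j

instance {n : ℕ} : DecidablePred (Avoids132 (n := n)) := fun σ => by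
  unfold Avoids132; infer_instance

/-- The set `S_n(132)` of 132-avoiding permutations of `{1,…,n}`. -/
def Av132 (n : ℕ) : Finset (Equiv.Perm (Fin n)) :=
  Finset.univ.filter Avoids132

/-- `Q n a b c d = Σ_{σ ∈ S_n(132)} x^{mmp^{(a,b,c,d)}(σ)}`, a polynomial in `ℤ[x]`. -/
noncomputable def Q (n a b c d : ℕ) : Polynomial ℤ :=
  ∑ σ ∈ Av132 n, Polynomial.X ^ (mmp a b c d σ)

lemma coeff_Q (n a b c d r : ℕ) :
    (Q n a b c d).coeff r = (((Av132 n).filter (fun σ => mmp a b c d σ = r)).card : ℤ) := by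
  unfold Q
  rw [finsetSum_coeff]
  simp only [coeff_X_pow]
  rw [Finset.card_filter]
  push_cast
  exact Finset.sum_congr rfl fun σ _ => by simp [eq_comm]

lemma av_apply {n : ℕ} {σ : Equiv.Perm (Fin n)} (h : Avoids132 σ) {i j k : Fin n}
    (hij : i < j) (hjk : j < k) (hik : σ i < σ k) : σ j < σ k := by
  by_contra hc
  have hne : σ j ≠ σ k := fun e => hjk.ne (σ.injective e)
  exact h ⟨i, j, k, hij, hjk, hik, lt_of_le_of_ne (not_lt.1 hc) hne.symm⟩

/-- the underlying function of the glued permutation -/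
def glueFun {i j n : ℕ} (h : i + j = n) (π : Equiv.Perm (Fin i)) (τ : Equiv.Perm (Fin j))
    (k : Fin (n + 1)) : Fin (n + 1) :=
  if hk : k.val < i then ⟨(π ⟨k, hk⟩).val + j, by have := (π ⟨k, hk⟩).isLt; omega⟩
  else if hk2 : k.val = i then ⟨n, by omega⟩
  else ⟨(τ ⟨k.val - i - 1, by have := k.isLt; omega⟩).val, by
    have := (τ ⟨k.val - i - 1, by have := k.isLt; omega⟩).isLt; omega⟩

lemma glueFun_lt {i j n : ℕ} (h : i + j = n) (π : Equiv.Perm (Fin i)) (τ : Equiv.Perm (Fin j))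
    (k : Fin (n + 1)) (hk : k.val < i) : (glueFun h π τ k).val = (π ⟨k, hk⟩).val + j := by
  simp [glueFun, hk]

lemma glueFun_eq {i j n : ℕ} (h : i + j = n) (π : Equiv.Perm (Fin i)) (τ : Equiv.Perm (Fin j))
    (k : Fin (n + 1)) (hk : k.val = i) : (glueFun h π τ k).val = n := by
  simp [glueFun, hk]

lemma glueFun_gt {i j n : ℕ} (h : i + j = n) (π : Equiv.Perm (Fin i)) (τ : Equiv.Perm (Fin j))
    (k : Fin (n + 1)) (hk : i < k.val) (hk' : k.val - i - 1 < j) :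
    (glueFun h π τ k).val = (τ ⟨k.val - i - 1, hk'⟩).val := by
  have h1 : ¬ k.val < i := by omega
  have h2 : ¬ k.val = i := by omega
  simp [glueFun, h1, h2]

lemma perm_fin_inj {n : ℕ} (π : Equiv.Perm (Fin n)) {a b : ℕ} (ha : a < n) (hb : b < n)
    (h : (π ⟨a, ha⟩).val = (π ⟨b, hb⟩).val) : a = b := by
  have := π.injective (Fin.ext h)
  simpa using this

lemma glueFun_inj {i j n : ℕ} (h : i + j = n) (π : Equiv.Perm (Fin i)) (τ : Equiv.Perm (Fin j)) :
    Function.Injective (glueFun h π τ) := by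
  intro a b hab
  have hab' := congrArg Fin.val hab
  have ha := a.isLt
  have hb := b.isLt
  apply Fin.ext
  rcases lt_trichotomy a.val i with h1 | h1 | h1 <;> rcases lt_trichotomy b.val i with h2 | h2 | h2
  · rw [glueFun_lt h π τ a h1, glueFun_lt h π τ b h2] at hab'
    exact perm_fin_inj π h1 h2 (by omega)
  · rw [glueFun_lt h π τ a h1, glueFun_eq h π τ b h2] at hab'
    have := (π ⟨a, h1⟩).isLt
    omega
  · rw [glueFun_lt h π τ a h1, glueFun_gt h π τ b h2 (by omega)] at hab'
    have := (τ ⟨b.val - i - 1, by omega⟩).isLt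
    omega
  · rw [glueFun_eq h π τ a h1, glueFun_lt h π τ b h2] at hab'
    have := (π ⟨b, h2⟩).isLt
    omega
  · omega
  · rw [glueFun_eq h π τ a h1, glueFun_gt h π τ b h2 (by omega)] at hab'
    have := (τ ⟨b.val - i - 1, by omega⟩).isLt
    omega
  · rw [glueFun_gt h π τ a h1 (by omega), glueFun_lt h π τ b h2] at hab'
    have := (τ ⟨a.val - i - 1, by omega⟩).isLt
    omega
  · rw [glueFun_gt h π τ a h1 (by omega), glueFun_eq h π τ b h2] at hab'
    have := (τ ⟨a.val - i - 1, by omega⟩).isLt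
    omega
  · rw [glueFun_gt h π τ a h1 (by omega), glueFun_gt h π τ b h2 (by omega)] at hab'
    have := perm_fin_inj τ _ _ hab'
    omega

/-- a permutation from an injective self-map of `Fin n` -/
noncomputable def permOf {n : ℕ} (f : Fin n → Fin n) (hf : Function.Injective f) :
    Equiv.Perm (Fin n) := Equiv.ofBijective f (Finite.injective_iff_bijective.1 hf)

@[simp] lemma permOf_apply {n : ℕ} (f : Fin n → Fin n) (hf : Function.Injective f) (k : Fin n) :
    permOf f hf k = f k := rfl

lemma glue_avoids {i j n : ℕ} (h : i + j = n) (π : Equiv.Perm (Fin i)) (τ : Equiv.Perm (Fin j))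
    (hπ : Avoids132 π) (hτ : Avoids132 τ) : Avoids132 (permOf _ (glueFun_inj h π τ)) := by
  rintro ⟨a, b, c, hab, hbc, hac, hcb⟩
  simp only [permOf_apply, Fin.lt_def] at *
  have hc := c.isLt
  have small : ∀ k : Fin (n+1), i < k.val → (glueFun h π τ k).val < j := fun k hk => by
    rw [glueFun_gt h π τ k hk (by omega)]; exact Fin.isLt _
  have big : ∀ k : Fin (n+1), k.val ≤ i → j ≤ (glueFun h π τ k).val := fun k hk => by
    rcases hk.lt_or_eq with hk | hk
    · rw [glueFun_lt h π τ k hk]; omega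
    · rw [glueFun_eq h π τ k hk]; omega
  have hb' := (glueFun h π τ b).isLt
  rcases lt_trichotomy c.val i with h1 | h1 | h1
  · rw [glueFun_lt h π τ a (by omega), glueFun_lt h π τ c h1] at hac
    rw [glueFun_lt h π τ b (by omega), glueFun_lt h π τ c h1] at hcb
    exact hπ ⟨⟨a, by omega⟩, ⟨b, by omega⟩, ⟨c, h1⟩, hab, hbc,
      Fin.lt_def.2 (by omega), Fin.lt_def.2 (by omega)⟩
  · rw [glueFun_eq h π τ c h1] at hcb; omega
  · have h2 := small c h1
    have h3 : i < a.val := by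
      by_contra h3
      have := big a (by omega)
      omega
    rw [glueFun_gt h π τ a h3 (by omega), glueFun_gt h π τ c h1 (by omega)] at hac
    rw [glueFun_gt h π τ b (by omega) (by omega), glueFun_gt h π τ c h1 (by omega)] at hcb
    exact hτ ⟨⟨a - i - 1, by omega⟩, ⟨b - i - 1, by omega⟩, ⟨c - i - 1, by omega⟩,
      Fin.lt_def.2 (by simp only; omega), Fin.lt_def.2 (by simp only; omega), hac, hcb⟩

lemma fiber_card {i j n : ℕ} (h : i + j = n) (p : Fin (n + 1)) (hp : p.val = i) :
    ((Av132 (n + 1)).filter (fun σ => σ p = Fin.last n)).card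
      = (Av132 i).card * (Av132 j).card := by
  rw [← Finset.card_product]
  symm
  refine Finset.card_bij (fun x _ => permOf _ (glueFun_inj h x.1 x.2)) ?_ ?_ ?_
  · rintro ⟨π, τ⟩ hx
    simp only [Av132, mem_product, mem_filter, mem_univ, true_and] at hx ⊢
    refine ⟨glue_avoids h π τ hx.1 hx.2, Fin.ext ?_⟩
    rw [permOf_apply, glueFun_eq h π τ p hp]; simp
  · rintro ⟨π, τ⟩ _ ⟨π', τ'⟩ _ heq
    have heq' : ∀ k, (glueFun h π τ k).val = (glueFun h π' τ' k).val := fun k => by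
      have := congrArg (fun e : Equiv.Perm (Fin (n+1)) => (e k).val) heq
      simpa using this
    simp only [Prod.mk.injEq]
    constructor
    · ext k
      have h1 := k.isLt
      have := heq' ⟨k, by omega⟩
      rw [glueFun_lt h π τ _ h1, glueFun_lt h π' τ' _ h1] at this
      simp only [Fin.eta] at this
      omega
    · ext k
      have h1 := k.isLt
      have := heq' ⟨i + 1 + k, by omega⟩
      have h2 : i + 1 + k.val - i - 1 = k.val := by omega
      rw [glueFun_gt h π τ _ (by simp only; omega) (by simp only; omega),
        glueFun_gt h π' τ' _ (by simp only; omega) (by simp only; omega)] at this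
      simpa only [h2] using this
  · intro σ hσ
    simp only [Av132, mem_filter, mem_univ, true_and] at hσ
    obtain ⟨hav, hlast⟩ := hσ
    have key : ∀ k l : Fin (n+1), k < p → p < l → σ l < σ k := by
      intro k l hk hl
      by_contra hc
      have hne : σ k ≠ σ l := fun e => (hk.trans hl).ne (σ.injective e)
      have := av_apply hav hk hl (lt_of_le_of_ne (not_lt.1 hc) hne)
      rw [hlast] at this
      exact absurd this (not_lt.2 (Fin.le_last _))
    have key2 : ∀ k l : Fin (n+1), k ≤ p → p < l → σ l < σ k := by
      intro k l hk hl
      rcases hk.lt_or_eq with hk | rfl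
      · exact key k l hk hl
      · rw [hlast]
        exact lt_of_le_of_ne (Fin.le_last _) fun e => hl.ne (σ.injective (hlast.trans e.symm))
    have small : ∀ l : Fin (n+1), p < l → (σ l).val < j := by
      intro l hl
      have h1 : (Finset.Iic p).card ≤ (Finset.Ioi (σ l)).card :=
        Finset.card_le_card_of_injOn σ (by
          intro k hk
          simp only [Finset.coe_Iic, Set.mem_Iic] at hk
          simpa using key2 k l hk hl) σ.injective.injOn
      rw [Fin.card_Iic, Fin.card_Ioi] at h1
      omega
    have big : ∀ k : Fin (n+1), k < p → j ≤ (σ k).val := by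
      intro k hk
      have h1 : (Finset.Ioi p).card ≤ (Finset.Iio (σ k)).card :=
        Finset.card_le_card_of_injOn σ (by
          intro l hl
          simp only [Finset.coe_Ioi, Set.mem_Ioi] at hl
          simpa using key k l hk hl) σ.injective.injOn
      rw [Fin.card_Ioi, Fin.card_Iio] at h1
      omega
    have top : ∀ k : Fin (n+1), k < p → (σ k).val < n := by
      intro k hk
      have h1 : σ k ≠ Fin.last n := fun e => hk.ne (σ.injective (e.trans hlast.symm))
      have := Fin.lt_last_iff_ne_last.2 h1
      simpa [Fin.lt_def] using this
    let f : Fin i → Fin i := fun k => ⟨(σ ⟨k, by omega⟩).val - j, by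
      have h1 := big ⟨k, by omega⟩ (Fin.lt_def.2 (by simp only; omega))
      have h2 := top ⟨k, by omega⟩ (Fin.lt_def.2 (by simp only; omega))
      omega⟩
    let g : Fin j → Fin j := fun k => ⟨(σ ⟨i + 1 + k, by omega⟩).val,
      small ⟨i + 1 + k, by omega⟩ (Fin.lt_def.2 (by simp only; omega))⟩
    have hf : Function.Injective f := by
      intro a b hab
      have h1 := big ⟨a, by omega⟩ (Fin.lt_def.2 (by simp only; omega))
      have h2 := big ⟨b, by omega⟩ (Fin.lt_def.2 (by simp only; omega))
      have h3 := congrArg Fin.val hab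
      simp only [f] at h3
      have := perm_fin_inj σ (a := a) (b := b) (by omega) (by omega) (by omega)
      exact Fin.ext this
    have hg : Function.Injective g := by
      intro a b hab
      have h3 := congrArg Fin.val hab
      simp only [g] at h3
      have := perm_fin_inj σ (a := i + 1 + a) (b := i + 1 + b) (by omega) (by omega) h3
      exact Fin.ext (by omega)
    refine ⟨(permOf f hf, permOf g hg), ?_, ?_⟩
    · simp only [Av132, mem_product, mem_filter, mem_univ, true_and]
      constructor
      · rintro ⟨a, b, c, hab, hbc, hac, hcb⟩
        simp only [permOf_apply, Fin.lt_def, f] at hac hcb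
        exact hav ⟨⟨a, by omega⟩, ⟨b, by omega⟩, ⟨c, by omega⟩, hab, hbc,
          Fin.lt_def.2 (by omega), Fin.lt_def.2 (by omega)⟩
      · rintro ⟨a, b, c, hab, hbc, hac, hcb⟩
        simp only [permOf_apply, Fin.lt_def, g] at hac hcb hab hbc
        exact hav ⟨⟨i + 1 + a, by omega⟩, ⟨i + 1 + b, by omega⟩, ⟨i + 1 + c, by omega⟩,
          Fin.lt_def.2 (by simp only; omega), Fin.lt_def.2 (by simp only; omega),
          Fin.lt_def.2 hac, Fin.lt_def.2 hcb⟩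
    · ext k
      have hk := k.isLt
      rw [permOf_apply]
      rcases lt_trichotomy k.val i with h1 | h1 | h1
      · rw [glueFun_lt h _ _ k h1]
        have := big k (Fin.lt_def.2 (by omega))
        simp only [permOf_apply, f, Fin.eta]
        omega
      · rw [glueFun_eq h _ _ k h1]
        have : k = p := Fin.ext (by omega)
        rw [this, hlast]; simp
      · rw [glueFun_gt h _ _ k h1 (by omega)]
        have h2 : i + 1 + (k.val - i - 1) = k.val := by omega
        simp only [permOf_apply, g, h2, Fin.eta]

lemma card_Av132 (n : ℕ) : (Av132 n).card = catalan n := by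
  induction n using Nat.strong_induction_on with
  | _ n ih =>
    cases n with
    | zero => rw [catalan_zero]; decide
    | succ n =>
      rw [catalan_succ, Finset.card_eq_sum_card_fiberwise
        (f := fun σ : Equiv.Perm (Fin (n+1)) => σ.symm (Fin.last n)) (t := Finset.univ)
        (fun _ _ => by simp)]
      refine Finset.sum_congr rfl fun p _ => ?_
      rw [← ih p (by omega), ← ih (n - p) (by omega),
        ← fiber_card (i := p) (j := n - p) (n := n) (by omega) p rfl]
      congr 1
      ext σ
      simp only [mem_filter]
      rw [Equiv.symm_apply_eq, eq_comm]

/-- the middle positions -/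
def Mid (m n : ℕ) : Finset (Fin n) := Finset.univ.filter (fun k => m < k.val ∧ k.val + 1 < n)

lemma card_Mid (m n : ℕ) : (Mid m n).card = n - 2 - m := by
  have : (Mid m n).card = (Finset.Ico (m + 1) (n - 1)).card := by
    refine Finset.card_bij (fun k _ => k.val) ?_ ?_ ?_
    · intro k hk; simp only [Mid, mem_filter, mem_univ, true_and] at hk; simp; omega
    · intro a _ b _ hab; exact Fin.ext hab
    · intro b hb
      simp only [mem_Ico] at hb
      exact ⟨⟨b, by omega⟩, by simp [Mid]; omega, rfl⟩
  rw [this, Nat.card_Ico]; omega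

lemma match_mid {m n : ℕ} (σ : Equiv.Perm (Fin n)) (k : Fin n)
    (h : MatchesMMP 1 1 m 0 σ k) : k ∈ Mid m n := by
  obtain ⟨h1, h2, h3, -⟩ := h
  simp only [Mid, mem_filter, mem_univ, true_and]
  constructor
  · have hd : Disjoint (Finset.univ.filter (fun j => j < k ∧ σ k < σ j))
        (Finset.univ.filter (fun j => j < k ∧ σ j < σ k)) := by
      rw [Finset.disjoint_left]
      intro j hj hj'
      simp only [mem_filter, mem_univ, true_and] at hj hj'
      exact absurd hj.2 (not_lt.2 hj'.2.le)
    have hsub : (Finset.univ.filter (fun j => j < k ∧ σ k < σ j)) ∪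
        (Finset.univ.filter (fun j => j < k ∧ σ j < σ k)) ⊆ Finset.Iio k := by
      intro j hj
      simp only [mem_union, mem_filter, mem_univ, true_and] at hj
      rw [mem_Iio]; rcases hj with hj | hj <;> exact hj.1
    have := Finset.card_le_card hsub
    rw [Finset.card_union_of_disjoint hd, Fin.card_Iio] at this
    omega
  · obtain ⟨j, hj⟩ := Finset.card_pos.1 h1
    simp only [mem_filter, mem_univ, true_and, Fin.lt_def] at hj
    omega

lemma mmp_le {m n : ℕ} (σ : Equiv.Perm (Fin n)) : mmp 1 1 m 0 σ ≤ n - 2 - m := by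
  rw [← card_Mid]
  exact Finset.card_le_card fun k hk => match_mid σ k (Finset.mem_filter.1 hk).2

lemma mmp_eq_iff {m n : ℕ} (σ : Equiv.Perm (Fin n)) :
    mmp 1 1 m 0 σ = n - 2 - m ↔ ∀ k ∈ Mid m n, MatchesMMP 1 1 m 0 σ k := by
  rw [← card_Mid]
  have hsub : Finset.univ.filter (MatchesMMP 1 1 m 0 σ) ⊆ Mid m n :=
    fun k hk => match_mid σ k (Finset.mem_filter.1 hk).2
  constructor
  · intro h k hk
    rw [← Finset.eq_of_subset_of_card_le hsub h.ge] at hk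
    exact (Finset.mem_filter.1 hk).2
  · intro h
    exact congrArg Finset.card (Finset.Subset.antisymm hsub fun k hk => by
      simpa using h k hk)

/-- the underlying function of the extremal permutations -/
def extFun {m n : ℕ} (hn : 3 + m ≤ n) (π : Equiv.Perm (Fin m)) (b : Bool) (k : Fin n) : Fin n :=
  if k.val = 0 then ⟨if b then n - 1 else n - 2, by split_ifs <;> omega⟩
  else if hk : k.val - 1 < m then ⟨(π ⟨k.val - 1, hk⟩).val, by
    have := (π ⟨k.val - 1, hk⟩).isLt; omega⟩
  else if k.val = n - 1 then ⟨if b then n - 2 else n - 1, by split_ifs <;> omega⟩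
  else ⟨k.val - 1, by omega⟩

section ext
variable {m n : ℕ} (hn : 3 + m ≤ n) (π : Equiv.Perm (Fin m)) (b : Bool) (k : Fin n)

lemma ext_zero (hk : k.val = 0) : (extFun hn π b k).val = if b then n - 1 else n - 2 := by
  simp [extFun, hk]

lemma ext_low (hk : 0 < k.val) (hk' : k.val - 1 < m) :
    (extFun hn π b k).val = (π ⟨k.val - 1, hk'⟩).val := by
  have : k.val ≠ 0 := by omega
  simp [extFun, this, hk']

lemma ext_last (hk : k.val = n - 1) :
    (extFun hn π b k).val = if b then n - 2 else n - 1 := by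
  have h1 : k.val ≠ 0 := by omega
  have h2 : ¬ k.val - 1 < m := by omega
  have h3 : n - 1 ≠ 0 := by omega
  have h4 : ¬ n - 1 - 1 < m := by omega
  simp [extFun, hk, h3, h4]

lemma ext_mid (hk : m < k.val) (hk' : k.val + 1 < n) : (extFun hn π b k).val = k.val - 1 := by
  have h1 : k.val ≠ 0 := by omega
  have h2 : ¬ k.val - 1 < m := by omega
  have h3 : k.val ≠ n - 1 := by omega
  unfold extFun
  rw [if_neg h1, dif_neg h2, if_neg h3]

lemma ext_cases : (k.val = 0 ∧ (extFun hn π b k).val = if b then n - 1 else n - 2) ∨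
    (0 < k.val ∧ k.val ≤ m ∧ (extFun hn π b k).val < m) ∨
    (m < k.val ∧ k.val + 1 < n ∧ (extFun hn π b k).val = k.val - 1) ∨
    (k.val = n - 1 ∧ (extFun hn π b k).val = if b then n - 2 else n - 1) := by
  have hk := k.isLt
  by_cases h0 : k.val = 0
  · exact Or.inl ⟨h0, ext_zero hn π b k h0⟩
  by_cases h1 : k.val ≤ m
  · refine Or.inr (Or.inl ⟨by omega, h1, ?_⟩)
    rw [ext_low hn π b k (by omega) (by omega)]
    exact Fin.isLt _
  by_cases h2 : k.val = n - 1
  · exact Or.inr (Or.inr (Or.inr ⟨h2, ext_last hn π b k h2⟩))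
  · exact Or.inr (Or.inr (Or.inl ⟨by omega, by omega, ext_mid hn π b k (by omega) (by omega)⟩))

lemma ext_inj : Function.Injective (extFun hn π b) := by
  intro x y hxy
  have hxy' := congrArg Fin.val hxy
  apply Fin.ext
  by_cases hl : (0 < x.val ∧ x.val ≤ m) ∧ (0 < y.val ∧ y.val ≤ m)
  · rw [ext_low hn π b x (by omega) (by omega), ext_low hn π b y (by omega) (by omega)] at hxy'
    have := perm_fin_inj π _ _ hxy'
    omega
  · have hx := ext_cases hn π b x
    have hy := ext_cases hn π b y
    cases b <;> simp only [if_true, Bool.false_eq_true, if_false] at hx hy <;> omega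

lemma ext_avoids (hπ : Avoids132 π) : Avoids132 (permOf _ (ext_inj hn π b)) := by
  rintro ⟨x, y, z, hxy, hyz, hxz, hzy⟩
  simp only [permOf_apply, Fin.lt_def] at *
  by_cases hl : 0 < x.val ∧ z.val ≤ m
  · rw [ext_low hn π b x (by omega) (by omega), ext_low hn π b z (by omega) (by omega)] at hxz
    rw [ext_low hn π b z (by omega) (by omega), ext_low hn π b y (by omega) (by omega)] at hzy
    exact hπ ⟨⟨x - 1, by omega⟩, ⟨y - 1, by omega⟩, ⟨z - 1, by omega⟩,
      Fin.lt_def.2 (by simp only; omega), Fin.lt_def.2 (by simp only; omega), hxz, hzy⟩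
  · have hx := ext_cases hn π b x
    have hy := ext_cases hn π b y
    have hz := ext_cases hn π b z
    cases b <;> simp only [if_true, Bool.false_eq_true, if_false] at hx hy hz <;> omega

lemma ext_match (hk : k ∈ Mid m n) : MatchesMMP 1 1 m 0 (permOf _ (ext_inj hn π b)) k := by
  simp only [Mid, mem_filter, mem_univ, true_and] at hk
  have h0 := ext_zero hn π b ⟨0, by omega⟩ rfl
  have hl := ext_last hn π b ⟨n - 1, by omega⟩ rfl
  have hm := ext_mid hn π b k hk.1 hk.2
  refine ⟨Finset.card_pos.2 ⟨⟨n - 1, by omega⟩, ?_⟩, Finset.card_pos.2 ⟨⟨0, by omega⟩, ?_⟩,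
    ?_, Nat.zero_le _⟩
  · simp only [permOf_apply, mem_filter, mem_univ, true_and, Fin.lt_def, hl, hm]
    split_ifs <;> omega
  · simp only [permOf_apply, mem_filter, mem_univ, true_and, Fin.lt_def, h0, hm]
    split_ifs <;> omega
  · calc m = (Finset.univ : Finset (Fin m)).card := by simp
      _ ≤ _ := Finset.card_le_card_of_injOn (fun j : Fin m => (⟨j.val + 1, by omega⟩ : Fin n)) (by
          intro j _
          have := ext_low hn π b ⟨j.val + 1, by omega⟩ (by simp) (by simp)
          have h2 := (π j).isLt
          simp only [Nat.add_sub_cancel, Fin.eta] at this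
          simp only [permOf_apply, coe_filter, mem_univ, true_and, Set.mem_ofPred_eq, Fin.lt_def,
            this, hm]
          omega) (by
          intro x _ y _ hxy
          simp only [Fin.mk.injEq] at hxy
          exact Fin.ext (by omega))

end ext

lemma val_eq_card {n : ℕ} (σ : Equiv.Perm (Fin n)) (k : Fin n) :
    (σ k).val = (Finset.univ.filter (fun j => σ j < σ k)).card := by
  rw [← Fin.card_Iio]
  symm
  refine Finset.card_bij (fun j _ => σ j) ?_ ?_ ?_
  · intro j hj; simpa using hj
  · intro a _ c _ h; exact σ.injective h
  · intro v hv; exact ⟨σ.symm v, by simpa using hv, by simp⟩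

lemma card_fin_range {n : ℕ} (P : Fin n → Prop) [DecidablePred P] (a c : ℕ) (hc : c ≤ n)
    (h : ∀ j : Fin n, P j ↔ a ≤ j.val ∧ j.val < c) :
    (Finset.univ.filter P).card = c - a := by
  rw [← Nat.card_Ico]
  refine Finset.card_bij (fun j _ => j.val) ?_ ?_ ?_
  · intro j hj; simpa [h] using hj
  · intro a _ c _ h; exact Fin.ext h
  · intro v hv
    simp only [mem_Ico] at hv
    exact ⟨⟨v, by omega⟩, by simpa [h] using hv, rfl⟩

section struct
variable {m n : ℕ} (hm : 1 ≤ m) (hn : 3 + m ≤ n) (σ : Equiv.Perm (Fin n)) (hav : Avoids132 σ)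
  (hmat : ∀ k ∈ Mid m n, MatchesMMP 1 1 m 0 σ k)
include hm hn hav hmat

/-- Each middle entry is below the first entry and above all other earlier ones. -/
lemma mid_struct (k : ℕ) (hk : k < n) (h1 : m < k) (h2 : k + 1 < n) :
    σ ⟨k, hk⟩ < σ ⟨0, by omega⟩ ∧ ∀ j : Fin n, 0 < j.val → j.val < k → σ j < σ ⟨k, hk⟩ := by
  induction k using Nat.strong_induction_on with
  | _ k ih =>
    obtain ⟨-, hb, hc, -⟩ := hmat ⟨k, hk⟩ (by simp [Mid]; omega)
    set K : Fin n := ⟨k, hk⟩ with hK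
    set O : Fin n := ⟨0, by omega⟩ with hO
    have hne : ∀ j, j < K → σ j ≠ σ K := fun j hj e => hj.ne (σ.injective e)
    -- some non-first earlier entry below
    by_cases hbase : k = m + 1
    · -- no earlier entry above, other than the first
      have hO' : σ K < σ O := by
        by_contra hcon
        have hOK : σ O < σ K := lt_of_le_of_ne (not_lt.1 hcon) (hne O (Fin.lt_def.2 (by simp [hO, hK]; omega)))
        obtain ⟨j, hj⟩ := Finset.card_pos.1 hb
        simp only [mem_filter, mem_univ, true_and] at hj
        have hOj : O < j := by
          rw [Fin.lt_def]
          rcases Nat.eq_zero_or_pos j.val with h | h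
          · have : j = O := Fin.ext h
            rw [this] at hj
            exact absurd hj.2 hcon
          · exact h
        exact absurd (av_apply hav hOj hj.1 hOK) (not_lt.2 hj.2.le)
      refine ⟨hO', fun j hj0 hjk => ?_⟩
      by_contra hcon
      have hsub : Finset.univ.filter (fun j => j < K ∧ σ j < σ K) ⊆
          ((Finset.Iio K).erase O).erase j := by
        intro i hi
        simp only [mem_filter, mem_univ, true_and] at hi
        simp only [mem_erase, mem_Iio]
        refine ⟨fun e => hcon (e ▸ hi.2), fun e => ?_, hi.1⟩
        rw [e] at hi
        exact absurd hi.2 (not_lt.2 hO'.le)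
      have := Finset.card_le_card hsub
      rw [Finset.card_erase_of_mem, Finset.card_erase_of_mem, Fin.card_Iio] at this
      · simp only [hK] at this
        simp only [hK] at hc
        omega
      · simp only [mem_Iio, Fin.lt_def, hO, hK]; omega
      · simp only [mem_erase, mem_Iio, Fin.lt_def, hK, hO]
        exact ⟨fun e => by rw [e] at hj0; simp at hj0, hjk⟩
    · obtain ⟨p1, p2⟩ := ih (k - 1) (by omega) (by omega) (by omega) (by omega)
      set P : Fin n := ⟨k - 1, by omega⟩ with hP
      have hPK : P < K := Fin.lt_def.2 (by simp only [hP, hK]; omega)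
      have hPK' : σ P < σ K := by
        by_contra hcon
        have hKP : σ K < σ P := lt_of_le_of_ne (not_lt.1 hcon) (hne P hPK).symm
        obtain ⟨j, hj⟩ := Finset.card_pos.1 (lt_of_lt_of_le hm hc)
        simp only [mem_filter, mem_univ, true_and] at hj
        have hjP : j < P := by
          have h3 : j ≠ P := fun e => by rw [e] at hj; exact hcon hj.2
          have h4 : j.val ≠ P.val := fun e => h3 (Fin.ext e)
          have := hj.1
          simp only [Fin.lt_def, hP, hK] at *
          omega
        exact hcon (av_apply hav hjP hPK hj.2)
      have hrest : ∀ j : Fin n, 0 < j.val → j.val < k → σ j < σ K := by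
        intro j hj0 hjk
        rcases Nat.lt_or_ge j.val (k - 1) with h | h
        · exact (p2 j hj0 h).trans hPK'
        · have : j = P := Fin.ext (by simp only [hP]; omega)
          rw [this]; exact hPK'
      refine ⟨?_, hrest⟩
      obtain ⟨j, hj⟩ := Finset.card_pos.1 hb
      simp only [mem_filter, mem_univ, true_and] at hj
      have : j = O := by
        apply Fin.ext
        by_contra h0
        exact absurd (hrest j (Nat.pos_of_ne_zero h0) (Fin.lt_def.1 hj.1)) (not_lt.2 hj.2.le)
      rw [this] at hj
      exact hj.2

lemma last_gt (j : Fin n) (h0 : 0 < j.val) (h1 : j.val + 1 < n) : σ j < σ ⟨n - 1, by omega⟩ := by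
  have hlast : σ ⟨n - 2, by omega⟩ < σ ⟨n - 1, by omega⟩ := by
    obtain ⟨ha, -⟩ := hmat ⟨n - 2, by omega⟩ (by simp [Mid]; omega)
    obtain ⟨j, hj⟩ := Finset.card_pos.1 ha
    simp only [mem_filter, mem_univ, true_and] at hj
    have : j = ⟨n - 1, by omega⟩ := Fin.ext (by
      have := hj.1; simp only [Fin.lt_def] at this ⊢; omega)
    rw [← this]; exact hj.2
  rcases Nat.lt_or_ge j.val (n - 2) with h | h
  · exact ((mid_struct hm hn σ hav hmat (n - 2) (by omega) (by omega) (by omega)).2 j h0 h).trans hlast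
  · have : j = ⟨n - 2, by omega⟩ := Fin.ext (by simp only; omega)
    exact lt_of_eq_of_lt (congrArg σ this) hlast

lemma first_gt (j : Fin n) (h0 : 0 < j.val) (h1 : j.val + 1 < n) : σ j < σ ⟨0, by omega⟩ := by
  have h := mid_struct hm hn σ hav hmat (n - 2) (by omega) (by omega) (by omega)
  rcases Nat.lt_or_ge j.val (n - 2) with h' | h'
  · exact (h.2 j h0 h').trans h.1
  · have : j = ⟨n - 2, by omega⟩ := Fin.ext (by simp only; omega)
    exact lt_of_eq_of_lt (congrArg σ this) h.1

lemma mid_val (k : Fin n) (h1 : m < k.val) (h2 : k.val + 1 < n) : (σ k).val = k.val - 1 := by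
  rw [val_eq_card, card_fin_range _ 1 k.val (by omega)]
  intro j
  constructor
  · intro hj
    refine ⟨?_, ?_⟩
    · by_contra h
      have : j = ⟨0, by omega⟩ := Fin.ext (by simp only; omega)
      rw [this] at hj
      exact absurd hj (not_lt.2 (first_gt hm hn σ hav hmat k (by omega) h2).le)
    · by_contra h
      rcases Nat.lt_or_ge k.val j.val with h3 | h3
      · rcases Nat.lt_or_ge (j.val + 1) n with h4 | h4
        · exact absurd hj (not_lt.2
            ((mid_struct hm hn σ hav hmat j j.isLt (by omega) h4).2 k (by omega) h3).le)
        · have : j = ⟨n - 1, by omega⟩ := Fin.ext (by simp only; omega)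
          rw [this] at hj
          exact absurd hj (not_lt.2 (last_gt hm hn σ hav hmat k (by omega) h2).le)
      · have : j = k := Fin.ext (by omega)
        rw [this] at hj
        exact lt_irrefl _ hj
  · rintro ⟨h3, h4⟩
    exact (mid_struct hm hn σ hav hmat k k.isLt h1 h2).2 j h3 h4

lemma low_val (k : Fin n) (h0 : 0 < k.val) (h1 : k.val ≤ m) : (σ k).val < m := by
  have h := (mid_struct hm hn σ hav hmat (m + 1) (by omega) (by omega) (by omega)).2 k h0 (by omega)
  have h' := mid_val hm hn σ hav hmat ⟨m + 1, by omega⟩ (by simp) (by simp only; omega)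
  rw [Fin.lt_def, h'] at h
  simpa using h

lemma ends_val : ∃ b : Bool, (σ ⟨0, by omega⟩).val = (if b then n - 1 else n - 2) ∧
    (σ ⟨n - 1, by omega⟩).val = (if b then n - 2 else n - 1) := by
  have hne : σ ⟨0, by omega⟩ ≠ σ ⟨n - 1, by omega⟩ := fun e => by
    have := congrArg Fin.val (σ.injective e)
    simp only at this; omega
  -- lower bounds for both end values
  have hcard : ∀ k : Fin n, (∀ j : Fin n, 0 < j.val → j.val + 1 < n → σ j < σ k) →
      n - 2 ≤ (σ k).val := by
    intro k hk
    rw [val_eq_card]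
    calc n - 2 = (Finset.univ.filter (fun j : Fin n => 1 ≤ j.val ∧ j.val < n - 1)).card := by
          rw [card_fin_range _ 1 (n - 1) (by omega) (fun j => Iff.rfl)]; omega
      _ ≤ _ := Finset.card_le_card fun j hj => by
          simp only [mem_filter, mem_univ, true_and] at hj ⊢
          exact hk j hj.1 (by omega)
  have h1 := hcard ⟨0, by omega⟩ (fun j a c => first_gt hm hn σ hav hmat j a c)
  have h2 := hcard ⟨n - 1, by omega⟩ (fun j a c => last_gt hm hn σ hav hmat j a c)
  have h3 := (σ ⟨0, by omega⟩).isLt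
  have h4 := (σ ⟨n - 1, by omega⟩).isLt
  have h5 : (σ ⟨0, by omega⟩).val ≠ (σ ⟨n - 1, by omega⟩).val := fun e => hne (Fin.ext e)
  by_cases hc : (σ ⟨0, by omega⟩).val = n - 1
  · exact ⟨true, by simp only [if_true]; omega⟩
  · exact ⟨false, by simp only [Bool.false_eq_true, if_false]; omega⟩

end struct

lemma ext_card (m n : ℕ) (hm : 1 ≤ m) (hn : 3 + m ≤ n) :
    ((Av132 n).filter (fun σ => mmp 1 1 m 0 σ = n - 2 - m)).card = 2 * catalan m := by
  have hp : ((Av132 m) ×ˢ (Finset.univ : Finset Bool)).card = 2 * catalan m := by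
    rw [Finset.card_product, card_Av132]; simp [mul_comm]
  rw [← hp]
  symm
  refine Finset.card_bij (fun x _ => permOf _ (ext_inj hn x.1 x.2)) ?_ ?_ ?_
  · rintro ⟨π, b⟩ hx
    simp only [Av132, mem_product, mem_filter, mem_univ, true_and, and_true] at hx ⊢
    exact ⟨ext_avoids hn π b hx, (mmp_eq_iff _).2 fun k hk => ext_match hn π b k hk⟩
  · rintro ⟨π, b⟩ _ ⟨π', b'⟩ _ heq
    have heq' : ∀ k, (extFun hn π b k).val = (extFun hn π' b' k).val := fun k => by
      have := congrArg (fun e : Equiv.Perm (Fin n) => (e k).val) heq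
      simpa using this
    simp only [Prod.mk.injEq]
    constructor
    · ext k
      have := heq' ⟨k + 1, by omega⟩
      rw [ext_low hn π b _ (by simp) (by simp), ext_low hn π' b' _ (by simp) (by simp)] at this
      simpa using this
    · have := heq' ⟨0, by omega⟩
      rw [ext_zero hn π b _ rfl, ext_zero hn π' b' _ rfl] at this
      cases b <;> cases b' <;> simp at this ⊢ <;> omega
  · intro σ hσ
    simp only [Av132, mem_filter, mem_univ, true_and] at hσ
    obtain ⟨hav, hmat⟩ := hσ
    rw [mmp_eq_iff] at hmat
    obtain ⟨b, hb0, hb1⟩ := ends_val hm hn σ hav hmat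
    let f : Fin m → Fin m := fun k => ⟨(σ ⟨k + 1, by omega⟩).val,
      low_val hm hn σ hav hmat ⟨k + 1, by omega⟩ (by simp) (by simp only; omega)⟩
    have hf : Function.Injective f := by
      intro x y hxy
      have h3 := congrArg Fin.val hxy
      simp only [f] at h3
      have := perm_fin_inj σ (a := x + 1) (b := y + 1) (by omega) (by omega) h3
      exact Fin.ext (by omega)
    refine ⟨(permOf f hf, b), ?_, ?_⟩
    · simp only [Av132, mem_product, mem_filter, mem_univ, true_and, and_true]
      rintro ⟨x, y, z, hxy, hyz, hxz, hzy⟩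
      simp only [permOf_apply, Fin.lt_def, f] at hxy hyz hxz hzy
      exact hav ⟨⟨x + 1, by omega⟩, ⟨y + 1, by omega⟩, ⟨z + 1, by omega⟩,
        Fin.lt_def.2 (by simp only; omega), Fin.lt_def.2 (by simp only; omega),
        Fin.lt_def.2 hxz, Fin.lt_def.2 hzy⟩
    · ext k
      have hk := k.isLt
      rw [permOf_apply]
      by_cases h0 : k.val = 0
      · have : k = ⟨0, by omega⟩ := Fin.ext h0
        rw [ext_zero hn _ _ k h0, this, hb0]
      by_cases h1 : k.val ≤ m
      · rw [ext_low hn _ _ k (by omega) (by omega)]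
        have h2 : k.val - 1 + 1 = k.val := by omega
        simp only [permOf_apply, f, h2, Fin.eta]
      by_cases h2 : k.val = n - 1
      · have : k = ⟨n - 1, by omega⟩ := Fin.ext h2
        rw [ext_last hn _ _ k h2, this, hb1]
      · rw [ext_mid hn _ _ k (by omega) (by omega),
          mid_val hm hn σ hav hmat k (by omega) (by omega)]

/-- for `m ≥ 1` and `n ≥ 3 + m`, the highest power of `x` in
`Q_{n,132}^{(1,1,m,0)}(x)` is `x^{n-2-m}`, with coefficient `2·C_m`. -/
theorem stmt2 (m n : ℕ) (hm : 1 ≤ m) (hn : 3 + m ≤ n) :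
    (Q n 1 1 m 0).coeff (n - 2 - m) = (2 * catalan m : ℤ) ∧
    ∀ r : ℕ, n - 2 - m < r → (Q n 1 1 m 0).coeff r = 0 := by
  refine ⟨?_, fun r hr => ?_⟩
  · rw [coeff_Q, ext_card m n hm hn]; push_cast; rfl
  · rw [coeff_Q, Finset.filter_false_of_mem]
    · simp
    · intro σ _ h
      have := mmp_le (m := m) σ
      omega
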